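/- Let Ω ⊂ ℝ³ be a bounded open set equipped with Lebesgue measure, let A₀, A₁ : Ω → ℝ^{3×3} be measurable matrix-valued maps with x ↦ |A₁(x) − A₀(x)|² Lebesgue integrable over Ω, and let q : Ω → ℝ be measurable with q(x) ≥ 0 for a.e. x. Assume there are constants σ > 0 and Q ≥ 0 such that for a.e. x ∈ Ω: ‖A₀(x)v‖ ≥ σ‖v‖ for every v ∈ ℝ³, and q(x)·|det A₀(x)| ≤ Q. If the function x ↦ q(x)·(|det A₁(x)| − |det A₀(x)| − sgn(det A₀(x))·cof(A₀(x)) : (A₁(x) − A₀(x))) is integrable on Ω, then ∫_Ω q(x)·(|det A₁(x)| − |det A₀(x)| − sgn(det A₀(x))·cof(A₀(x)) : (A₁(x) − A₀(x))) dx ≥ −(c / (2σ²))·Q·∫_Ω |A₁(x) − A₀(x)|² dx, where c := 1 + (3/2)(1 + √3). -/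

import Mathlib

noncomputable section

open Matrix MeasureTheory

/-- Frobenius inner product `A : B = ∑_{i,j} A_{ij} B_{ij}`. -/
def frobInner {d : ℕ} (A B : Matrix (Fin d) (Fin d) ℝ) : ℝ := ∑ i, ∑ j, A i j * B i j

/-- Frobenius norm `|A| = √(A : A)`. -/
def frobNorm {d : ℕ} (A : Matrix (Fin d) (Fin d) ℝ) : ℝ := Real.sqrt (∑ i, ∑ j, (A i j) ^ 2)

/-- Cofactor matrix: the transpose of the adjugate, so that `Mᵀ * cof M = det M • 1`. -/
def cof {d : ℕ} (M : Matrix (Fin d) (Fin d) ℝ) : Matrix (Fin d) (Fin d) ℝ := (Matrix.adjugate M)ᵀ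

lemma frobInner_cof {d : ℕ} (A B : Matrix (Fin d) (Fin d) ℝ) :
    frobInner (cof A) B = (A.adjugate * B).trace := by
  simp only [frobInner, cof, Matrix.trace, Matrix.diag_apply, Matrix.mul_apply,
    Matrix.transpose_apply]
  exact Finset.sum_comm

lemma frobNorm_sq {d : ℕ} (A : Matrix (Fin d) (Fin d) ℝ) :
    (frobNorm A) ^ 2 = ∑ i, ∑ j, (A i j) ^ 2 :=
  Real.sq_sqrt (by positivity)

lemma trace_sq_le (X : Matrix (Fin 3) (Fin 3) ℝ) : X.trace ^ 2 ≤ 3 * (frobNorm X) ^ 2 := by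
  rw [frobNorm_sq]
  simp only [Matrix.trace_fin_three, Fin.sum_univ_three]
  nlinarith [sq_nonneg (X 0 0 - X 1 1), sq_nonneg (X 0 0 - X 2 2), sq_nonneg (X 1 1 - X 2 2),
    sq_nonneg (X 0 1), sq_nonneg (X 0 2), sq_nonneg (X 1 0), sq_nonneg (X 1 2),
    sq_nonneg (X 2 0), sq_nonneg (X 2 1)]

lemma det_sq_le_prod (X : Matrix (Fin 3) (Fin 3) ℝ) :
    X.det ^ 2 ≤ ∏ i, ∑ j, (X i j) ^ 2 := by
  simp only [Matrix.det_fin_three, Fin.sum_univ_three, Fin.prod_univ_three]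
  generalize X 0 0 = a, X 0 1 = b, X 0 2 = c, X 1 0 = d, X 1 1 = e, X 1 2 = f, X 2 0 = g,
    X 2 1 = h, X 2 2 = k
  have hcross : (e * k - f * h) ^ 2 + (f * g - d * k) ^ 2 + (d * h - e * g) ^ 2
      ≤ (d ^ 2 + e ^ 2 + f ^ 2) * (g ^ 2 + h ^ 2 + k ^ 2) := by
    nlinarith [sq_nonneg (d * g + e * h + f * k)]
  have hdot : ∀ u v w : ℝ, (a * u + b * v + c * w) ^ 2
      ≤ (a ^ 2 + b ^ 2 + c ^ 2) * (u ^ 2 + v ^ 2 + w ^ 2) := fun u v w => by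
    nlinarith [sq_nonneg (a * v - b * u), sq_nonneg (a * w - c * u), sq_nonneg (b * w - c * v)]
  have hmul := mul_le_mul_of_nonneg_left hcross (by positivity : 0 ≤ a ^ 2 + b ^ 2 + c ^ 2)
  have h1 := hdot (e * k - f * h) (f * g - d * k) (d * h - e * g)
  calc _ = (a * (e * k - f * h) + b * (f * g - d * k) + c * (d * h - e * g)) ^ 2 := by ring
    _ ≤ _ := h1.trans (hmul.trans_eq (by ring))

lemma det_sq_le_frobNorm (X : Matrix (Fin 3) (Fin 3) ℝ) :
    X.det ^ 2 ≤ ((frobNorm X) ^ 2) ^ 3 := by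
  rw [frobNorm_sq]
  refine (det_sq_le_prod X).trans ?_
  calc ∏ i, ∑ j, (X i j) ^ 2 ≤ ∏ _i : Fin 3, ∑ i, ∑ j, (X i j) ^ 2 := by
        refine Finset.prod_le_prod (fun i _ => by positivity) fun i _ => ?_
        exact Finset.single_le_sum (f := fun i => ∑ j, (X i j) ^ 2)
          (fun i _ => by positivity) (Finset.mem_univ i)
    _ = _ := by simp

lemma det_one_add_ge (X : Matrix (Fin 3) (Fin 3) ℝ) :
    1 + X.trace - (frobNorm X) ^ 2 / 2 + X.det ≤ (1 + X).det := by
  have htr := sq_nonneg X.trace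
  rw [frobNorm_sq]
  simp only [Matrix.trace_fin_three, Matrix.det_fin_three, Fin.sum_univ_three, Matrix.add_apply,
    Matrix.one_apply] at *
  simp
  nlinarith [sq_nonneg (X 0 1 - X 1 0), sq_nonneg (X 0 2 - X 2 0), sq_nonneg (X 1 2 - X 2 1)]

lemma abs_det_one_add_ge (X : Matrix (Fin 3) (Fin 3) ℝ) :
    -(5 / 2) * (frobNorm X) ^ 2 ≤ |(1 + X).det| - 1 - X.trace := by
  have htr := trace_sq_le X
  have hdet := det_sq_le_frobNorm X
  have hone := (det_one_add_ge X).trans (le_abs_self _)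
  have habs := abs_nonneg (1 + X).det
  have hN : 0 ≤ (frobNorm X) ^ 2 := by positivity
  generalize (frobNorm X) ^ 2 = N at *
  rcases le_total N 4 with h | h
  · have hd : X.det ^ 2 ≤ (2 * N) ^ 2 := by nlinarith [mul_nonneg hN hN]
    have := (abs_le_of_sq_le_sq' hd (by positivity)).1
    linarith
  · nlinarith [sq_nonneg (X.trace - 1)]

lemma frobNorm_mul_ge {A : Matrix (Fin 3) (Fin 3) ℝ} {σ : ℝ} (hσ : 0 < σ)
    (hA : ∀ v : EuclideanSpace ℝ (Fin 3), σ * ‖v‖ ≤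
      ‖(EuclideanSpace.equiv (Fin 3) ℝ).symm
        (A.mulVec (EuclideanSpace.equiv (Fin 3) ℝ v))‖) (X : Matrix (Fin 3) (Fin 3) ℝ) :
    σ ^ 2 * (frobNorm X) ^ 2 ≤ (frobNorm (A * X)) ^ 2 := by
  simp only [frobNorm_sq]
  rw [Finset.sum_comm, Finset.sum_comm (f := fun i j => ((A * X) i j) ^ 2), Finset.mul_sum]
  refine Finset.sum_le_sum fun j _ => ?_
  have h := pow_le_pow_left₀ (by positivity) (hA (WithLp.toLp 2 fun i => X i j)) 2
  rw [mul_pow, EuclideanSpace.norm_sq_eq, EuclideanSpace.norm_sq_eq] at h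
  simpa [Matrix.mul_apply, Matrix.mulVec, dotProduct] using h

lemma det_ne_zero_of_bounded_below {A : Matrix (Fin 3) (Fin 3) ℝ} {σ : ℝ} (hσ : 0 < σ)
    (hA : ∀ v : EuclideanSpace ℝ (Fin 3), σ * ‖v‖ ≤
      ‖(EuclideanSpace.equiv (Fin 3) ℝ).symm
        (A.mulVec (EuclideanSpace.equiv (Fin 3) ℝ v))‖) : A.det ≠ 0 := by
  intro h0
  obtain ⟨v, hv, hAv⟩ := Matrix.exists_mulVec_eq_zero_iff.mpr h0
  have h := hA (WithLp.toLp 2 v)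
  have hz : EuclideanSpace.equiv (Fin 3) ℝ (WithLp.toLp 2 v) = v := rfl
  rw [hz, hAv, map_zero, norm_zero] at h
  have hn : ‖(WithLp.toLp 2 v : EuclideanSpace ℝ (Fin 3))‖ ≤ 0 :=
    nonpos_of_mul_nonpos_right h hσ
  exact hv (by simpa using hn)

lemma abs_det_bregman_ge {A B : Matrix (Fin 3) (Fin 3) ℝ} {σ : ℝ} (hσ : 0 < σ)
    (hA : ∀ v : EuclideanSpace ℝ (Fin 3), σ * ‖v‖ ≤
      ‖(EuclideanSpace.equiv (Fin 3) ℝ).symm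
        (A.mulVec (EuclideanSpace.equiv (Fin 3) ℝ v))‖) :
    |A.det| * (-(5 / 2) * ((frobNorm (B - A)) ^ 2 / σ ^ 2)) ≤
      |B.det| - |A.det| - Real.sign A.det * frobInner (cof A) (B - A) := by
  have hdet := det_ne_zero_of_bounded_below hσ hA
  obtain ⟨X, hX⟩ : ∃ X, A * X = B - A :=
    ⟨A⁻¹ * (B - A), Matrix.mul_nonsing_inv_cancel_left _ _ (isUnit_iff_ne_zero.mpr hdet)⟩
  have hB : B = A * (1 + X) := by rw [mul_add, mul_one, hX]; abel
  have hsign : Real.sign A.det * A.det = |A.det| := by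
    rcases hdet.lt_or_gt with h | h
    · rw [Real.sign_of_neg h, abs_of_neg h]; ring
    · rw [Real.sign_of_pos h, abs_of_pos h]; ring
  have hN := frobNorm_mul_ge hσ hA X
  have hX1 : (frobNorm X) ^ 2 ≤ (frobNorm (B - A)) ^ 2 / σ ^ 2 := by
    rw [le_div_iff₀ (by positivity), ← hX]; linarith
  have hX2 := abs_det_one_add_ge X
  have hinner : frobInner (cof A) (B - A) = A.det * X.trace := by
    rw [frobInner_cof, ← hX, ← Matrix.mul_assoc, Matrix.adjugate_mul, Matrix.smul_mul,
      Matrix.one_mul, Matrix.trace_smul, smul_eq_mul]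
  have hBd : |B.det| = |A.det| * |(1 + X).det| := by rw [hB, Matrix.det_mul, abs_mul]
  rw [hBd, hinner, ← mul_assoc (Real.sign A.det), hsign]
  calc _ ≤ |A.det| * (|(1 + X).det| - 1 - X.trace) := by gcongr; linarith
    _ = _ := by ring

/-- integrated Bregman-divergence bound for the polyconvex integrand
`(q,B) ↦ q·|det B|` in three dimensions. With `c := 1 + (3/2)(1 + √3)`,
if a.e. on the bounded open set `Ω` the singular values of `A₀(x)` are ≥ σ and
`q(x)·|det A₀(x)| ≤ Q`, `q ≥ 0` a.e., then
`∫_Ω q·(|det A₁| − |det A₀| − sgn(det A₀)·cof A₀ : (A₁ − A₀))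
  ≥ −(c/(2σ²))·Q·∫_Ω |A₁ − A₀|²`. -/
theorem stmt_8 (Ω : Set (EuclideanSpace ℝ (Fin 3))) (hΩo : IsOpen Ω)
    (hΩb : Bornology.IsBounded Ω)
    (A₀ A₁ : EuclideanSpace ℝ (Fin 3) → Matrix (Fin 3) (Fin 3) ℝ)
    (hA₀ : ∀ i j, Measurable fun x => A₀ x i j) (hA₁ : ∀ i j, Measurable fun x => A₁ x i j)
    (hI2 : IntegrableOn (fun x => (frobNorm (A₁ x - A₀ x)) ^ 2) Ω volume)
    (q : EuclideanSpace ℝ (Fin 3) → ℝ) (hq : Measurable q)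
    (hq0 : ∀ᵐ x ∂volume.restrict Ω, 0 ≤ q x)
    (σ : ℝ) (hσ : 0 < σ) (Q : ℝ) (hQ : 0 ≤ Q)
    (hae : ∀ᵐ x ∂volume.restrict Ω,
      (∀ v : EuclideanSpace ℝ (Fin 3), σ * ‖v‖ ≤
        ‖(EuclideanSpace.equiv (Fin 3) ℝ).symm
          ((A₀ x).mulVec (EuclideanSpace.equiv (Fin 3) ℝ v))‖) ∧
      q x * |(A₀ x).det| ≤ Q)
    (hInt : IntegrableOn (fun x => q x * (|(A₁ x).det| - |(A₀ x).det|
      - Real.sign (A₀ x).det * frobInner (cof (A₀ x)) (A₁ x - A₀ x))) Ω volume) :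
    ∫ x in Ω, q x * (|(A₁ x).det| - |(A₀ x).det|
        - Real.sign (A₀ x).det * frobInner (cof (A₀ x)) (A₁ x - A₀ x))
      ≥ -((1 + (3 / 2) * (1 + Real.sqrt 3)) / (2 * σ ^ 2)) * Q
          * ∫ x in Ω, (frobNorm (A₁ x - A₀ x)) ^ 2 := by
  have hc : (5 : ℝ) / 2 ≤ (1 + (3 / 2) * (1 + Real.sqrt 3)) / 2 := by
    have : (5 / 3 : ℝ) ≤ Real.sqrt 3 := Real.le_sqrt_of_sq_le (by norm_num)
    linarith
  rw [ge_iff_le, ← integral_const_mul]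
  refine integral_mono_ae (hI2.const_mul _) hInt ?_
  filter_upwards [hq0, hae] with x hqx hx
  have hbreg := mul_le_mul_of_nonneg_left (abs_det_bregman_ge (B := A₁ x) hσ hx.1) hqx
  refine le_trans ?_ hbreg
  have hN : 0 ≤ (frobNorm (A₁ x - A₀ x)) ^ 2 / σ ^ 2 := by positivity
  have hmul := mul_le_mul hc hx.2 (by positivity) (by linarith)
  have hfin := mul_le_mul_of_nonneg_right hmul hN
  calc _ = -((1 + (3 / 2) * (1 + Real.sqrt 3)) / 2 * Q
        * ((frobNorm (A₁ x - A₀ x)) ^ 2 / σ ^ 2)) := by field_simp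
    _ ≤ -(5 / 2 * (q x * |(A₀ x).det|) * ((frobNorm (A₁ x - A₀ x)) ^ 2 / σ ^ 2)) :=
        neg_le_neg hfin
    _ = _ := by ring
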